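/- arXiv:1109.4660 — 2 statements merged into one kernel-verified Lean document; each statement's English description precedes it below -/
import Mathlib

section
/- Let n, m be natural numbers with n+m ≥ 1 and let a be a real number with a ≠ 0 and a ≠ 1. Then for every k with 0 ≤ k ≤ ⌊(n+m−1)/2⌋, β_k^{(n,m)}(a) = (−1)^{n+m−1} · a^{n+k+1} (1−a)^{k−n} · ((1/2)_{n+m−k} (1/2)_k)/((1/2)_n (1/2)_m) · C(n−k−1, n+m−2k−1) · Σ_{j=0}^{n+m+1} ((−m−n−1)_j (n−k)_j)/((n+m−2k)_j · j!) · a^{−j} (the terminating series ₂F₁(−m−n−1, n−k; n+m−2k; 1/a); note n+m−2k ≥ 1 under the stated hypothesis), where C(n−k−1, n+m−2k−1) is the generalized binomial coefficient with (possibly negative) integer upper entry n−k−1. -/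
open Finset

/-- The Bessel polynomial `q_n`, normalized so that `q_n(0) = 1`. -/
noncomputable def besselQ (n : ℕ) (u : ℝ) : ℝ :=
  ∑ k ∈ Finset.range (n + 1),
    ((n.factorial : ℝ) * (2 * n - k).factorial * 2 ^ k) /
      ((2 * n).factorial * (n - k).factorial * k.factorial) * u ^ k

/-- The Pochhammer symbol `(x)_j = x (x+1) ⋯ (x+j-1)`. -/
noncomputable def poch (x : ℝ) (j : ℕ) : ℝ := ∏ i ∈ Finset.range j, (x + i)

/-- Generalized binomial coefficient with integer (possibly negative) upper entry. -/
noncomputable def gbinom (z : ℤ) (j : ℕ) : ℝ :=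
  (∏ i ∈ Finset.range j, ((z : ℝ) - i)) / j.factorial

open Polynomial in
/-- coefficients -/
noncomputable def bcf (n k : ℕ) : ℝ :=
  ((n.factorial : ℝ) * (2 * n - k).factorial * 2 ^ k) /
      ((2 * n).factorial * (n - k).factorial * k.factorial)

open Polynomial in
noncomputable def bq (n : ℕ) : ℝ[X] := ∑ k ∈ Finset.range (n + 1), C (bcf n k) * X ^ k

open Polynomial in
theorem bq_eval (n : ℕ) (u : ℝ) : (bq n).eval u = besselQ n u := by
  simp [bq, besselQ, bcf, eval_finsetSum]

open Polynomial in
theorem bq_coeff (n k : ℕ) : (bq n).coeff k = if k ≤ n then bcf n k else 0 := by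
  simp [bq, finsetSum_coeff, coeff_C_mul, coeff_X_pow]

theorem bcf_zero (n : ℕ) : bcf n 0 = 1 := by
  simp only [bcf]
  simp
  field_simp

theorem bcf_eq (k d : ℕ) : bcf (k + d) k = (((k+d).factorial : ℝ) * (2 * d + k).factorial * 2 ^ k) /
      ((2 * (k + d)).factorial * d.factorial * k.factorial) := by
  unfold bcf
  rw [show 2 * (k+d) - k = 2 * d + k by omega, show k + d - k = d by omega]

theorem bcf_one (n : ℕ) : bcf (n+1) 1 = 1 := by
  have := bcf_eq 1 n
  rw [add_comm 1 n] at this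
  rw [this]
  rw [show 2 * (n+1) = 2 * n + 1 + 1 by ring]
  simp only [Nat.factorial_succ]
  push_cast
  field_simp
  norm_num
  ring

theorem bcf_rec (k d : ℕ) : bcf (k + d + 1 + 2) (k+2) = bcf (k + d + 1 + 1) (k+2) +
    bcf (k + d + 1) k / ((2 * (k + d + 1) + 1) * (2 * (k+d + 1) + 3)) := by
  rw [show k + d + 1 + 2 = (k + 2) + (d + 1) by ring, bcf_eq,
    show k + d + 1 + 1 = (k + 2) + d by ring, bcf_eq, show k + d + 1 = k + (d+1) by ring, bcf_eq]
  rw [show 2 * (k + 2 + (d+1)) = 2 * (k + d) + 2 + 1 + 1 + 1 + 1 by ring,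
    show 2 * (k + 2 + d) = 2 * (k + d) + 2 + 1 + 1 by ring,
    show 2 * (k + (d + 1)) = 2 * (k + d) + 2 by ring,
    show 2 * (d+1) + (k + 2) = 2 * d + k + 1 + 1 + 1 + 1 by ring,
    show 2 * d + (k + 2) = 2 * d + k + 1 + 1 by ring,
    show 2 * (d+1) + k = 2 * d + k + 1 + 1 by ring,
    show k + 2 + (d+1) = k + d + 1 + 1 + 1 by ring,
    show k + 2 + d = k + d + 1 + 1 by ring,
    show k + (d+1) = k + d + 1 by ring]
  simp only [Nat.factorial_succ]
  push_cast
  field_simp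
  ring

theorem bcf_rec_top (k : ℕ) : bcf (k + 2) (k+2) = 
    bcf k k / ((2 * k + 1) * (2 * k + 3)) := by
  have h1 := bcf_eq (k+2) 0
  have h2 := bcf_eq k 0
  rw [add_zero] at h1 h2
  rw [h1, h2, show 2 * (k + 2) = 2 * k + 1 + 1 + 1 + 1 by ring]
  simp only [Nat.factorial_succ, mul_zero, zero_add]
  push_cast
  field_simp
  ring

theorem bcf_der (k d : ℕ) : (k + 2) * bcf (k + d + 1 + 1) (k+2) = bcf (k + d + 1 + 1) (k+1) -
    bcf (k + d + 1) k / (2 * (k + d + 1) + 1) := by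
  have e := bcf_eq (k+1) (d+1)
  rw [show k + 1 + (d+1) = k + d + 1 + 1 by ring] at e
  rw [e, show k + d + 1 + 1 = (k + 2) + d by ring, bcf_eq, show k + d + 1 = k + (d+1) by ring, bcf_eq]
  rw [
    show 2 * (k + 2 + d) = 2 * (k + d) + 2 + 1 + 1 by ring,
    show 2 * (k + (d + 1)) = 2 * (k + d) + 2 by ring,
    show 2 * d + (k + 2) = 2 * d + k + 1 + 1 by ring,
    show 2 * (d+1) + (k + 1) = 2 * d + k + 1 + 1 + 1 by ring,
    show 2 * (d+1) + k = 2 * d + k + 1 + 1 by ring,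
    show k + 2 + d = k + d + 1 + 1 by ring,
    show k + (d+1) = k + d + 1 by ring]
  simp only [Nat.factorial_succ]
  push_cast
  field_simp
  ring

theorem bcf_der_top (k : ℕ) : bcf (k + 1) (k+1) = 
    bcf k k / (2 * k + 1) := by
  have h1 := bcf_eq (k+1) 0
  have h2 := bcf_eq k 0
  rw [add_zero] at h1 h2
  rw [h1, h2, show 2 * (k + 1) = 2 * k + 1 + 1 by ring]
  simp only [Nat.factorial_succ, mul_zero, zero_add]
  push_cast
  field_simp
  ring

open Polynomial in
theorem bq_rec (n : ℕ) : bq (n+2) = bq (n+1) + C (1 / ((2 * (n:ℝ) + 1) * (2 * n + 3))) * (X ^ 2 * bq n) := by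
  ext k
  rw [coeff_add, coeff_C_mul, coeff_X_pow_mul']
  rcases k with _ | _ | k
  · simp [bq_coeff, bcf_zero]
  · simp [bq_coeff, bcf_one]
  · simp only [bq_coeff]
    rcases lt_trichotomy k n with h | h | h
    · obtain ⟨d, rfl⟩ := Nat.exists_eq_add_of_lt h
      rw [if_pos (by omega), if_pos (by omega), if_pos (by omega), if_pos (by omega)]
      have := bcf_rec k d
      rw [show k + 1 + 1 - 2 = k by omega, show k + 1 + 1 = k + 2 by ring, this]
      push_cast
      ring
    · subst h
      rw [if_pos (by omega), if_neg (by omega), if_pos (by omega), if_pos (by omega)]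
      rw [show k + 1 + 1 - 2 = k by omega, show k + 1 + 1 = k + 2 by ring, bcf_rec_top]
      ring
    · rw [if_neg (by omega), if_neg (by omega), if_pos (by omega), if_neg (by omega)]
      simp

open Polynomial in
theorem bq_der (n : ℕ) : derivative (bq (n+1)) = bq (n+1) - C (1 / (2 * (n:ℝ) + 1)) * (X * bq n) := by
  ext k
  rw [coeff_sub, coeff_C_mul, coeff_derivative]
  rcases k with _ | k
  · simp [bq_coeff, bcf_zero, bcf_one]
  · simp only [bq_coeff, coeff_X_mul]
    rcases lt_trichotomy k n with h | h | h
    · obtain ⟨d, rfl⟩ := Nat.exists_eq_add_of_lt h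
      rw [if_pos (by omega), if_pos (by omega), if_pos (by omega)]
      have := bcf_der k d
      rw [show k + 1 + 1 = k + 2 by ring]
      push_cast
      linear_combination this
    · subst h
      rw [if_neg (by omega), if_pos (by omega), if_pos (by omega)]
      rw [bcf_der_top]
      ring
    · rw [if_neg (by omega), if_neg (by omega), if_neg (by omega)]
      simp

open Polynomial in
theorem bq_zero : bq 0 = 1 := by
  simp [bq, bcf_zero]

open Polynomial in
theorem bq_one : bq 1 = 1 + X := by
  simp [bq, bcf_zero, Finset.sum_range_succ, bcf_one 0]

theorem bcf_top_ne (n : ℕ) : bcf n n ≠ 0 := by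
  unfold bcf
  positivity

open Polynomial in
theorem bq_degree (n : ℕ) : (bq n).degree = n := by
  apply le_antisymm
  · rw [degree_le_iff_coeff_zero]
    intro k hk
    rw [bq_coeff, if_neg (by exact_mod_cast not_le.mpr hk)]
  · apply le_degree_of_ne_zero
    rw [bq_coeff, if_pos le_rfl]
    exact bcf_top_ne n

noncomputable def bqSeq : Polynomial.Sequence ℝ := ⟨bq, bq_degree⟩

noncomputable def bqBasis : Module.Basis ℕ ℝ (Polynomial ℝ) :=
  bqSeq.basis (fun i => by
    simp)

theorem bqBasis_apply (n : ℕ) : bqBasis n = bq n := by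
  unfold bqBasis
  simp
  rfl

/-- The coordinate functionals. -/
noncomputable def Lc (k : ℕ) : Polynomial ℝ →ₗ[ℝ] ℝ := bqBasis.coord k

theorem Lc_bq (k j : ℕ) : Lc k (bq j) = if j = k then 1 else 0 := by
  rw [Lc, ← bqBasis_apply, Module.Basis.coord_apply, Module.Basis.repr_self, Finsupp.single_apply]

section
open Polynomial

theorem X2_bq (n : ℕ) : X ^ 2 * bq n =
    ((2 * (n:ℝ) + 1) * (2 * n + 3)) • (bq (n+2) - bq (n+1)) := by
  rw [bq_rec, add_sub_cancel_left, smul_eq_C_mul, ← mul_assoc, ← C_mul, mul_one_div_cancel]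
  · simp
  · positivity

theorem Lc_zero_X2 (P : ℝ[X]) : Lc 0 (X ^ 2 * P) = 0 := by
  have : (Lc 0) ∘ₗ (LinearMap.mulLeft ℝ (X ^ 2 : ℝ[X])) = 0 := by
    apply bqBasis.ext
    intro j
    simp only [LinearMap.comp_apply, LinearMap.mulLeft_apply, bqBasis_apply, X2_bq, map_smul, map_sub, Lc_bq]
    simp
  exact LinearMap.congr_fun this P

theorem Lc_one_X2 (P : ℝ[X]) : Lc 1 (X ^ 2 * P) = -3 * Lc 0 P := by
  have : (Lc 1) ∘ₗ (LinearMap.mulLeft ℝ (X ^ 2 : ℝ[X])) = (-3 : ℝ) • Lc 0 := by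
    apply bqBasis.ext
    intro j
    simp only [LinearMap.comp_apply, LinearMap.mulLeft_apply, bqBasis_apply, X2_bq, map_smul, map_sub, Lc_bq, LinearMap.smul_apply]
    rcases j with _ | j <;> simp
  exact LinearMap.congr_fun this P

theorem Lc_add_two_X2 (k : ℕ) (P : ℝ[X]) : Lc (k+2) (X ^ 2 * P) =
    (2 * k + 1) * (2 * k + 3) * Lc k P - (2 * k + 3) * (2 * k + 5) * Lc (k+1) P := by
  have : (Lc (k+2)) ∘ₗ (LinearMap.mulLeft ℝ (X ^ 2 : ℝ[X])) =
      ((2 * k + 1) * (2 * k + 3) : ℝ) • Lc k - ((2 * k + 3) * (2 * k + 5) : ℝ) • Lc (k+1) := by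
    apply bqBasis.ext
    intro j
    simp only [LinearMap.comp_apply, LinearMap.mulLeft_apply, bqBasis_apply, X2_bq, map_smul, map_sub, Lc_bq, LinearMap.smul_apply, LinearMap.sub_apply]
    by_cases h1 : j = k
    · subst h1; simp
    · by_cases h2 : j = k + 1
      · subst h2; simp; ring
      · have h3 : ¬ (j + 1 = k + 2) := by omega
        simp [h1, h2]
  exact LinearMap.congr_fun this P

noncomputable def Sop : ℝ[X] →ₗ[ℝ] ℝ[X] :=
  bqBasis.constr ℝ (fun j => match j with
    | 0 => 0
    | j + 1 => (1 / (2 * (j:ℝ) + 1)) • bq j)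

theorem Sop_zero : Sop (bq 0) = 0 := by
  rw [Sop, ← bqBasis_apply, Module.Basis.constr_basis]

theorem Sop_succ (j : ℕ) : Sop (bq (j+1)) = (1 / (2 * (j:ℝ) + 1)) • bq j := by
  rw [Sop, ← bqBasis_apply, Module.Basis.constr_basis]

theorem der_Sop (P : ℝ[X]) : derivative P = P - C (Lc 0 P) - X * Sop P := by
  have : derivative = LinearMap.id - (Algebra.linearMap ℝ ℝ[X]) ∘ₗ Lc 0 - (LinearMap.mulLeft ℝ (X : ℝ[X])) ∘ₗ Sop := by
    apply bqBasis.ext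
    intro j
    simp only [bqBasis_apply, LinearMap.sub_apply, LinearMap.comp_apply, LinearMap.mulLeft_apply, Lc_bq]
    rcases j with _ | j
    · rw [Sop_zero]; simp [bq_zero]
    · rw [bq_der, Sop_succ]
      simp [smul_eq_C_mul]
      ring
  exact LinearMap.congr_fun this P

theorem Lc_Sop (k : ℕ) (P : ℝ[X]) : Lc (k+1) P = (2 * k + 1) * Lc k (Sop P) := by
  have : Lc (k+1) = (2 * k + 1 : ℝ) • (Lc k ∘ₗ Sop) := by
    apply bqBasis.ext
    intro j
    simp only [bqBasis_apply, LinearMap.smul_apply, LinearMap.comp_apply, Lc_bq]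
    rcases j with _ | j
    · simp [Sop_zero]
    · rw [Sop_succ]
      simp only [map_smul, Lc_bq]
      by_cases h : j = k
      · subst h
        simp
        field_simp
      · simp [h]
  exact LinearMap.congr_fun this P

theorem Lc_of_der (P R : ℝ[X]) (h : derivative P = P - X * R) :
    Lc 0 P = 0 ∧ ∀ k : ℕ, Lc (k+1) P = (2 * k + 1) * Lc k R := by
  have h1 := der_Sop P
  rw [h] at h1
  have h0 : Lc 0 P = 0 := by
    have := congrArg (eval 0) h1
    simp at this
    linarith
  refine ⟨h0, fun k => ?_⟩
  rw [h0] at h1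
  have h2 : X * R = X * Sop P := by
    simp only [C_0, sub_zero] at h1
    linear_combination -h1
  rw [Lc_Sop, mul_left_cancel₀ X_ne_zero h2]

noncomputable def Pq (a : ℝ) (n m : ℕ) : ℝ[X] :=
  (bq n).comp (C a * X) * (bq m).comp (C (1 - a) * X)

theorem Pq_der (a : ℝ) (n m : ℕ) : derivative (Pq a (n+1) (m+1)) = Pq a (n+1) (m+1) -
    X * (C (a ^ 2 / (2 * n + 1)) * Pq a n (m+1) + C ((1-a) ^ 2 / (2 * m + 1)) * Pq a (n+1) m) := by
  simp only [Pq, derivative_mul, derivative_comp, bq_der, sub_comp, mul_comp, C_comp, X_comp,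
    derivative_C, derivative_X, zero_mul, mul_one, zero_add]
  have e1 : C (a ^ 2 / (2 * (n:ℝ) + 1)) = C a ^ 2 * C (1 / (2 * (n:ℝ) + 1)) := by
    rw [← C_pow, ← C_mul]; congr 1; ring
  have e2 : C ((1-a) ^ 2 / (2 * (m:ℝ) + 1)) = C (1-a) ^ 2 * C (1 / (2 * (m:ℝ) + 1)) := by
    rw [← C_pow, ← C_mul]; congr 1; ring
  have e3 : C (1 - a) = 1 - C a := by simp
  rw [e1, e2, e3]
  ring

theorem Pq_Lc_zero (a : ℝ) (n m : ℕ) : Lc 0 (Pq a (n+1) (m+1)) = 0 :=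
  (Lc_of_der _ _ (Pq_der a n m)).1

theorem Pq_Lc_succ (a : ℝ) (n m k : ℕ) : Lc (k+1) (Pq a (n+1) (m+1)) = (2 * k + 1) *
    (a ^ 2 / (2 * n + 1) * Lc k (Pq a n (m+1)) + (1-a) ^ 2 / (2 * m + 1) * Lc k (Pq a (n+1) m)) := by
  rw [(Lc_of_der _ _ (Pq_der a n m)).2]
  simp [← smul_eq_C_mul]

theorem Pq_small (a : ℝ) (k : ℕ) : ∀ n m : ℕ, k < n → k < m → Lc k (Pq a n m) = 0 := by
  induction k with
  | zero =>
    intro n m hn hm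
    obtain ⟨n, rfl⟩ := Nat.exists_eq_succ_of_ne_zero hn.ne'
    obtain ⟨m, rfl⟩ := Nat.exists_eq_succ_of_ne_zero hm.ne'
    exact Pq_Lc_zero a n m
  | succ k ih =>
    intro n m hn hm
    obtain ⟨n, rfl⟩ := Nat.exists_eq_succ_of_ne_zero (by omega : n ≠ 0)
    obtain ⟨m, rfl⟩ := Nat.exists_eq_succ_of_ne_zero (by omega : m ≠ 0)
    rw [Nat.succ_eq_add_one, Nat.succ_eq_add_one, Pq_Lc_succ, ih _ _ (by omega) (by omega), ih _ _ (by omega) (by omega)]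
    simp

noncomputable def Qq (c : ℝ) (m : ℕ) : ℝ[X] := (bq m).comp (C c * X)

theorem Qq_rec (c : ℝ) (m : ℕ) : Qq c (m+2) = Qq c (m+1) +
    (c ^ 2 / ((2 * (m:ℝ) + 1) * (2 * m + 3))) • (X ^ 2 * Qq c m) := by
  simp only [Qq, bq_rec, add_comp, mul_comp, C_comp, X_comp, pow_comp, smul_eq_C_mul]
  have e1 : C (c ^ 2 / ((2 * (m:ℝ) + 1) * (2 * m + 3))) =
      C c ^ 2 * C (1 / ((2 * (m:ℝ) + 1) * (2 * m + 3))) := by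
    rw [← C_pow, ← C_mul]; congr 1; ring
  rw [e1]
  ring

theorem Qq_zero (c : ℝ) : Qq c 0 = bq 0 := by simp [Qq, bq_zero]

theorem Qq_one (c : ℝ) : Qq c 1 = (1 - c) • bq 0 + c • bq 1 := by
  simp [Qq, bq_zero, bq_one, smul_eq_C_mul]
  ring

theorem Qq_Lc0 (c : ℝ) (m : ℕ) : Lc 0 (Qq c (m+2)) = Lc 0 (Qq c (m+1)) := by
  rw [Qq_rec, map_add, map_smul, Lc_zero_X2]; simp

theorem Qq_Lc1 (c : ℝ) (m : ℕ) : Lc 1 (Qq c (m+2)) = Lc 1 (Qq c (m+1)) +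
    c ^ 2 / ((2 * m + 1) * (2 * m + 3)) * (-3 * Lc 0 (Qq c m)) := by
  rw [Qq_rec, map_add, map_smul, Lc_one_X2]; simp

theorem Qq_Lc2 (c : ℝ) (m k : ℕ) : Lc (k+2) (Qq c (m+2)) = Lc (k+2) (Qq c (m+1)) +
    c ^ 2 / ((2 * m + 1) * (2 * m + 3)) *
    ((2 * k + 1) * (2 * k + 3) * Lc k (Qq c m) - (2 * k + 3) * (2 * k + 5) * Lc (k+1) (Qq c m)) := by
  rw [Qq_rec, map_add, map_smul, Lc_add_two_X2]; simp

theorem Qq_high (c : ℝ) (m : ℕ) : ∀ k, m < k → Lc k (Qq c m) = 0 := by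
  induction m using Nat.twoStepInduction with
  | zero => intro k hk; rw [Qq_zero, Lc_bq, if_neg (by omega)]
  | one => intro k hk; rw [Qq_one, map_add, map_smul, map_smul, Lc_bq, Lc_bq, if_neg (by omega), if_neg (by omega)]; simp
  | more m h1 h2 =>
    intro k hk
    obtain ⟨k, rfl⟩ : ∃ j, k = j + 2 := ⟨k - 2, by omega⟩
    rw [Qq_Lc2, h2 _ (by omega), h1 _ (by omega), h1 _ (by omega)]
    simp

theorem Qq_top (c : ℝ) (m : ℕ) : Lc m (Qq c m) = c ^ m := by
  induction m using Nat.twoStepInduction with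
  | zero => rw [Qq_zero, Lc_bq]; simp
  | one => rw [Qq_one, map_add, map_smul, map_smul, Lc_bq, Lc_bq]; simp
  | more m h1 h2 =>
    rw [Qq_Lc2, Qq_high c (m+1) (m+2) (by omega), h1, Qq_high c m (m+1) (by omega)]
    field_simp
    ring

noncomputable def Wp (a : ℝ) (e p : ℕ) : ℝ[X] := (1 + X) ^ e * (1 + C a * X) ^ p

theorem Wp_id (a : ℝ) (d p : ℕ) :
    C (2 * p + 3 : ℝ) * Wp a (d + p + 3) (p + 1) - C (2 * (d + p + 1) + 1 : ℝ) * Wp a (d + p + 2) p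
     - C (2 * p + 3 : ℝ) * (X ^ 2 * Wp a (d + p + 1) (p + 1)) +
      C ((2 * d + 1) * (1 - a) : ℝ) * (X * Wp a (d + p + 1) p)
     = C 2 * (X * derivative (Wp a (d + p + 2) (p + 1)) - C (d:ℝ) * Wp a (d + p + 2) (p + 1)) := by
  simp only [Wp, derivative_mul, derivative_pow, derivative_add, derivative_one, derivative_X, derivative_C, map_add, map_mul, map_sub, map_natCast, map_one, map_ofNat]
  simp only [show d + p + 2 - 1 = d + p + 1 by omega, add_tsub_cancel_right]
  push_cast
  ring

theorem coeff_euler (f : ℝ[X]) (d : ℕ) : (C 2 * (X * derivative f - C (d:ℝ) * f)).coeff d = 0 := by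
  rw [coeff_C_mul, coeff_sub, coeff_C_mul]
  rcases d with _ | d
  · simp
  · rw [coeff_X_mul, coeff_derivative]
    push_cast
    ring

theorem Wp_coeff1 (a : ℝ) (p : ℕ) :
    (2 * p + 3) * (Wp a (p + 4) (p + 1)).coeff 1 - (2 * (p + 2) + 1) * (Wp a (p + 3) p).coeff 1
      + 3 * (1 - a) * (Wp a (p + 2) p).coeff 0 = 0 := by
  have h := congrArg (fun f => coeff f 1) (Wp_id a 1 p)
  simp only [coeff_euler] at h
  simp only [coeff_add, coeff_sub, coeff_C_mul, coeff_X_pow_mul'] at h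
  have e0 := coeff_X_mul (Wp a (1 + p + 1) p) 0
  rw [zero_add] at e0
  rw [e0] at h
  norm_num at h
  rw [show 1 + p + 3 = p + 4 by ring, show 1 + p + 2 = p + 3 by ring, show 1 + p + 1 = p + 2 by ring] at h
  linear_combination h

theorem Wp_coeff2 (a : ℝ) (d p : ℕ) :
    (2 * p + 3) * (Wp a (d + p + 5) (p + 1)).coeff (d+2) - (2 * (d + p + 3) + 1) * (Wp a (d + p + 4) p).coeff (d+2)
     - (2 * p + 3) * (Wp a (d + p + 3) (p + 1)).coeff d
      + (2 * d + 5) * (1 - a) * (Wp a (d + p + 3) p).coeff (d+1) = 0 := by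
  have h := congrArg (fun f => coeff f (d+2)) (Wp_id a (d+2) p)
  simp only [coeff_euler] at h
  simp only [coeff_add, coeff_sub, coeff_C_mul, coeff_X_pow_mul] at h
  rw [show d + 2 = (d + 1) + 1 by rfl, coeff_X_mul] at h
  push_cast at h
  rw [show d + 1 + 1 + p + 3 = d + p + 5 by ring, show d + 1 + 1 + p + 2 = d + p + 4 by ring, show d + 1 + 1 + p + 1 = d + p + 3 by ring] at h
  linear_combination h

theorem Wp_coeff0 (a : ℝ) (e p : ℕ) : (Wp a e p).coeff 0 = 1 := by
  simp [Wp, coeff_zero_eq_eval_zero]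

theorem Wp_top (a : ℝ) (d : ℕ) : (Wp a (d+2) 0).coeff d = (d + 2) * (d + 1) / 2 := by
  rw [Wp, pow_zero, mul_one, add_comm, coeff_X_add_one_pow, Nat.choose_symm_add, Nat.cast_choose_two]
  push_cast
  ring

theorem poch_succ (x : ℝ) (j : ℕ) : poch x (j+1) = poch x j * (x + j) := by
  simp [poch, Finset.prod_range_succ]

theorem poch_zero (x : ℝ) : poch x 0 = 1 := by simp [poch]

theorem poch_pos (j : ℕ) : 0 < poch (1/2) j := by
  unfold poch
  apply Finset.prod_pos
  intro i _
  positivity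

theorem Qq_formula (a : ℝ) (m : ℕ) : ∀ d p : ℕ, m = d + 1 + p →
    Lc d (Qq (1 - a) m) = poch (1/2) (p+1) * poch (1/2) d / poch (1/2) m * a * (1 - a) ^ d
      * (Wp a (m+1) p).coeff d := by
  induction m using Nat.twoStepInduction with
  | zero => intro d p h; omega
  | one =>
    intro d p h
    obtain rfl : d = 0 := by omega
    obtain rfl : p = 0 := by omega
    rw [Qq_one, map_add, map_smul, map_smul, Lc_bq, Lc_bq, Wp_coeff0]
    simp [poch]
  | more m h1 h2 =>
    intro d p h
    rcases d with _ | _ | d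
    · rw [Qq_Lc0, h2 0 m (by ring), Wp_coeff0, Wp_coeff0]
      obtain rfl : p = m + 1 := by omega
      have := poch_pos (m+1)
      have := poch_pos (m+2)
      rw [show m + 1 + 1 = m + 2 by ring]
      field_simp
    · obtain rfl : p = m := by omega
      rw [zero_add, Qq_Lc1]
      rcases p with _ | p
      · have e := Wp_top a 1
        norm_num at e
        norm_num
        rw [e, Qq_top, Qq_zero, Lc_bq]
        simp [poch, Finset.prod_range_succ]
        ring
      · rw [h2 1 p (by ring), h1 0 p (by ring)]
        have e := Wp_coeff1 a p
        rw [show p + 1 + 1 + 1 = p + 3 by ring, show p + 1 + 2 + 1 = p + 4 by ring, show p + 1 + 1 = p + 2 by ring]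
        have hh := poch_pos (p+1)
        have e1 : poch (1/2) (p+3) = poch (1/2) (p+1) * (1/2 + (p + 1)) * (1/2 + (p+2)) := by
          rw [poch_succ, poch_succ]; push_cast; ring
        have e2 : poch (1/2) (p+2) = poch (1/2) (p+1) * (1/2 + (p + 1)) := by
          rw [poch_succ]; push_cast; ring
        have e3 : poch (1/2) 1 = 1/2 := by simp [poch]
        rw [show p + 1 + 2 = p + 3 by ring, e1, e2, e3, poch_zero]
        have f1 : (1/2 + ((p:ℝ) + 1)) ≠ 0 := by positivity
        have f2 : (1/2 + ((p:ℝ) + 2)) ≠ 0 := by positivity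
        push_cast
        have e' : (Wp a (p + 4) (p + 1)).coeff 1 = ((2 * (p + 2) + 1) * (Wp a (p + 3) p).coeff 1
            - 3 * (1 - a) * (Wp a (p + 2) p).coeff 0) / (2 * p + 3) := by
          rw [eq_div_iff (by positivity)]
          linear_combination e
        rw [e']
        field_simp
        ring
    · rw [Qq_Lc2]
      rcases p with _ | p
      · obtain rfl : m = d + 1 := by omega
        rw [Qq_top, Qq_top, h1 d 0 (by ring), Wp_top, show d + 1 + 2 + 1 = (d + 2) + 2 by ring, Wp_top]
        have hh := poch_pos d
        have e1 : poch (1/2) (d+3) = poch (1/2) d * (1/2 + d) * (1/2 + (d + 1)) * (1/2 + (d+2)) := by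
          rw [poch_succ, poch_succ, poch_succ]; push_cast; ring
        have e2 : poch (1/2) (d+2) = poch (1/2) d * (1/2 + d) * (1/2 + (d + 1)) := by
          rw [poch_succ, poch_succ]; push_cast; ring
        have e4 : poch (1/2) (d+1) = poch (1/2) d * (1/2 + d) := by
          rw [poch_succ]
        have e3 : poch (1/2) 1 = 1/2 := by simp [poch]
        rw [show d + 1 + 2 = d + 3 by ring, show d + 1 + 1 = d + 2 by ring, zero_add, e1, e2, e3, e4]
        push_cast
        field_simp
        ring
      · obtain rfl : m = d + p + 2 := by omega
        rw [h2 (d+2) p (by ring), h1 d (p+1) (by ring), h1 (d+1) p (by ring)]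
        have e := Wp_coeff2 a d p
        have hh := poch_pos (p+1)
        have hh3 := poch_pos (d+p+2)
        have hh2 := poch_pos d
        have e1 : poch (1/2) (p+2) = poch (1/2) (p+1) * (1/2 + (p + 1)) := by
          rw [poch_succ]; push_cast; ring
        have e2 : poch (1/2) (d+2) = poch (1/2) d * (1/2 + d) * (1/2 + (d + 1)) := by
          rw [poch_succ, poch_succ]; push_cast; ring
        have e4 : poch (1/2) (d+1) = poch (1/2) d * (1/2 + d) := by
          rw [poch_succ]
        have e5 : poch (1/2) (d+p+3) = poch (1/2) (d+p+2) * (1/2 + (d + p + 2)) := by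
          rw [poch_succ]; push_cast; ring
        have e6 : poch (1/2) (d+p+4) = poch (1/2) (d+p+2) * (1/2 + (d + p + 2)) * (1/2 + (d + p + 3)) := by
          rw [poch_succ, poch_succ]; push_cast; ring
        rw [show d + p + 2 + 1 + 1 = d + p + 4 by ring, show d + p + 2 + 2 + 1 = d + p + 5 by ring,
          show d + p + 2 + 1 = d + p + 3 by ring, show p + 1 + 1 = p + 2 by ring,
          show d + p + 2 + 2 = d + p + 4 by ring, show d + 1 + 1 = d + 2 by ring, e1, e2, e4, e5, e6]
        push_cast
        have e' : (Wp a (d + p + 5) (p + 1)).coeff (d+2) =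
            ((2 * (d + p + 3) + 1) * (Wp a (d + p + 4) p).coeff (d+2)
            + (2 * p + 3) * (Wp a (d + p + 3) (p + 1)).coeff d
            - (2 * d + 5) * (1 - a) * (Wp a (d + p + 3) p).coeff (d+1)) / (2 * p + 3) := by
          rw [eq_div_iff (by positivity)]
          linear_combination e
        rw [e']
        field_simp
        ring

theorem Pq_formula (a : ℝ) (n : ℕ) : ∀ d p : ℕ,
    Lc (n + d) (Pq a n (n + d + 1 + p)) =
      poch (1/2) (n + p + 1) * poch (1/2) (n + d) / (poch (1/2) n * poch (1/2) (n + d + 1 + p))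
      * a ^ (2 * n + 1) * (1 - a) ^ d * (Wp a (2 * n + d + p + 2) p).coeff d := by
  induction n with
  | zero =>
    intro d p
    have : Pq a 0 (0 + d + 1 + p) = Qq (1 - a) (d + 1 + p) := by
      simp [Pq, Qq, bq_zero]
    rw [this, zero_add, Qq_formula a _ d p rfl, poch_zero]
    simp only [zero_add, mul_zero, one_mul, pow_one]
    rw [show d + 1 + p + 1 = d + p + 2 by ring]
  | succ n ih =>
    intro d
    have key : ∀ e p : ℕ, Wp a (e+1) p = Wp a e (p+1) + C (1 - a) * (X * Wp a e p) := by
      intro e p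
      simp only [Wp, map_sub, map_one]
      ring
    induction d with
    | zero =>
      intro p
      have h1 := ih 0 (p+1)
      have h := Pq_Lc_succ a n (n + 1 + p) n
      rw [Pq_small a n (n+1) (n + 1 + p) (by omega) (by omega)] at h
      simp only [add_zero] at h1 ⊢
      rw [show n + 1 + 1 + p = n + 1 + p + 1 by ring, h, show n + 1 + p + 1 = n + 1 + (p + 1) by ring, h1]
      rw [Wp_coeff0, Wp_coeff0]
      have hh := poch_pos n
      have e1 := poch_succ (1/2) n
      rw [show n + 1 + (p+1) = n + (p + 1) + 1 by ring, e1]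
      field_simp
      ring
    | succ d ihd =>
      intro p
      have h1 := ih (d+1) (p+1)
      have h2 := ihd p
      have h := Pq_Lc_succ a n (n + d + 2 + p) (n + d + 1)
      rw [show n + 1 + (d + 1) = n + d + 1 + 1 by ring, show n + d + 1 + 1 + 1 + p = n + d + 2 + p + 1 by ring, h]
      rw [show n + (d + 1) + 1 + (p+1) = n + d + 2 + p + 1 by ring, show n + (d + 1) = n + d + 1 by ring] at h1
      rw [show n + 1 + d + 1 + p = n + d + 2 + p by ring, show n + 1 + d = n + d + 1 by ring] at h2
      rw [h1, h2]
      have k := congrArg (fun f => coeff f (d+1)) (key (2 * n + d + p + 4) p)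
      simp only [coeff_add, coeff_C_mul, coeff_X_mul] at k
      rw [show 2 * (n+1) + (d+1) + p + 2 = 2 * n + d + p + 4 + 1 by ring, k,
        show 2 * n + (d+1) + (p+1) + 2 = 2 * n + d + p + 4 by ring,
        show 2 * (n+1) + d + p + 2 = 2 * n + d + p + 4 by ring]
      have hh := poch_pos n
      have hh2 := poch_pos (n+d+2+p)
      have e1 := poch_succ (1/2) n
      have e2 := poch_succ (1/2) (n+d+1)
      have e3 := poch_succ (1/2) (n+d+2+p)
      rw [show n + 1 + p + 1 = n + (p + 1) + 1 by ring, e1, e2, e3]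
      push_cast
      field_simp
      ring
end

section
open Polynomial

noncomputable def fm (M B c : ℝ) (j : ℕ) : ℝ := poch (-M) j * poch B j / (poch c j * j.factorial)

noncomputable def Fm (M : ℕ) (B c x : ℝ) : ℝ := ∑ j ∈ Finset.range (M + 1), fm M B c j * x ^ j

theorem poch_succ' (x : ℝ) (j : ℕ) : poch x (j+1) = x * poch (x+1) j := by
  simp only [poch, Finset.prod_range_succ']
  rw [mul_comm]
  congr 1
  · simp
  · apply Finset.prod_congr rfl
    intro i _
    push_cast
    ring

theorem poch_pos' (x : ℝ) (hx : 0 < x) (j : ℕ) : 0 < poch x j := by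
  unfold poch
  apply Finset.prod_pos
  intro i _
  positivity

theorem poch_neg_eq_zero (M j : ℕ) (h : M < j) : poch (-(M:ℝ)) j = 0 := by
  unfold poch
  apply Finset.prod_eq_zero (Finset.mem_range.mpr h)
  ring

theorem fm_zero (M B c : ℝ) : fm M B c 0 = 1 := by simp [fm, poch]

theorem Fm_ext (M : ℕ) (B c x : ℝ) : Fm M B c x = ∑ j ∈ Finset.range (M + 1), fm M B c (j+1) * x ^ (j+1) + 1 := by
  have : Fm M B c x = ∑ j ∈ Finset.range (M + 1 + 1), fm M B c j * x ^ j := by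
    rw [Finset.sum_range_succ, Fm]
    simp [fm, poch_neg_eq_zero M (M+1) (by omega)]
  rw [this, Finset.sum_range_succ', fm_zero]
  simp

theorem Fm_succ (M : ℕ) (B c x : ℝ) : Fm (M+1) B c x =
    ∑ j ∈ Finset.range (M + 1), fm (M+1) B c (j+1) * x ^ (j+1) + 1 := by
  rw [Fm, Finset.sum_range_succ', fm_zero]
  simp

theorem fm_rec1 (M B c : ℝ) (hc : 0 < c) (j : ℕ) :
    fm (M+1) B c (j+1) = fm M B c (j+1) - B / c * fm M (B+1) (c+1) j := by
  unfold fm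
  rw [poch_succ' (-(M+1)), poch_succ (-M), poch_succ' B, poch_succ' c, Nat.factorial_succ,
    show -(M+1) + 1 = -M by ring]
  have := poch_pos' (c+1) (by linarith) j
  push_cast
  field_simp
  ring

theorem fm_rec2 (M B c : ℝ) (hc : 0 < c) (j : ℕ) :
    fm (M+1) B c (j+1) = fm M B c (j+1) - fm M B c j + (c - B) / c * fm M B (c+1) j := by
  unfold fm
  have h := poch_succ' c j
  rw [poch_succ c] at h
  have h' : poch (c+1) j = poch c j * (c + j) / c := by field_simp; linarith
  rw [poch_succ' (-(M+1)), poch_succ (-M), poch_succ B, h', poch_succ c, Nat.factorial_succ,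
    show -(M+1) + 1 = -M by ring]
  have := poch_pos' c hc j
  have hcj : 0 < c + j := by positivity
  push_cast
  field_simp
  ring

theorem Fm_rec1 (M : ℕ) (B c x : ℝ) (hc : 0 < c) :
    Fm (M+1) B c x = Fm M B c x - x * (B / c) * Fm M (B+1) (c+1) x := by
  rw [Fm_succ, Fm_ext M B c, Fm, Finset.mul_sum, add_sub_right_comm, ← Finset.sum_sub_distrib]
  congr 1
  apply Finset.sum_congr rfl
  intro j _
  rw [fm_rec1 _ _ _ hc]
  ring

theorem Fm_rec2 (M : ℕ) (B c x : ℝ) (hc : 0 < c) :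
    Fm (M+1) B c x = (1 - x) * Fm M B c x + x * ((c - B) / c) * Fm M B (c+1) x := by
  have : (1 - x) * Fm M B c x = (∑ j ∈ Finset.range (M + 1), fm M B c (j+1) * x ^ (j+1) + 1)
      - ∑ j ∈ Finset.range (M + 1), x * (fm M B c j * x ^ j) := by
    rw [← Fm_ext, ← Finset.mul_sum, ← Fm]; ring
  rw [this, Fm_succ, Fm, Finset.mul_sum, add_sub_right_comm, ← Finset.sum_sub_distrib, add_right_comm,
    ← Finset.sum_add_distrib]
  congr 1
  apply Finset.sum_congr rfl
  intro j _
  rw [fm_rec2 _ _ _ hc]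
  ring

theorem pfaff (x : ℝ) (hx : x ≠ 1) (M : ℕ) : ∀ B c : ℝ, 0 < c →
    Fm M B c x = (1 - x) ^ M * Fm M (c - B) c (x / (x - 1)) := by
  have hx1 : x - 1 ≠ 0 := sub_ne_zero.mpr hx
  induction M with
  | zero => intro B c _; simp [Fm, fm_zero, fm, poch]
  | succ M ih =>
    intro B c hc
    rw [Fm_rec1 _ _ _ _ hc, Fm_rec2 _ _ _ _ hc, ih B c hc, ih (B+1) (c+1) (by linarith),
      show c + 1 - (B + 1) = c - B by ring]
    generalize Fm M (c - B) c (x / (x - 1)) = u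
    generalize Fm M (c - B) (c+1) (x / (x - 1)) = v
    rw [pow_succ]
    generalize (1 - x) ^ M = w
    field_simp
    ring

theorem poch_neg (M j : ℕ) : poch (-(M:ℝ)) j = (-1) ^ j * (j.factorial * M.choose j) := by
  have : poch (-(M:ℝ)) j = (-1) ^ j * (M.descFactorial j : ℝ) := by
    induction j with
    | zero => simp [poch]
    | succ j ih =>
      rw [poch_succ, ih, Nat.descFactorial_succ]
      rcases le_or_gt j M with h | h
      · push_cast [Nat.cast_sub h]
        ring
      · rw [Nat.descFactorial_of_lt h]; simp
  rw [this, Nat.descFactorial_eq_factorial_mul_choose]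
  push_cast
  ring

theorem poch_nat (e j : ℕ) : poch ((e:ℝ) + 1) j = (e + j).factorial / e.factorial := by
  rw [eq_div_iff (by positivity)]
  induction j with
  | zero => simp [poch]
  | succ j ih =>
    rw [poch_succ, ← add_assoc, Nat.factorial_succ]
    push_cast
    linear_combination ((e:ℝ) + j + 1) * ih

theorem gbinom_neg (d e : ℕ) : gbinom (-(d:ℤ) - 1) e = (-1) ^ e * ((d + e).factorial / (d.factorial * e.factorial)) := by
  unfold gbinom
  have : ∏ i ∈ Finset.range e, (((-(d:ℤ) - 1 : ℤ) : ℝ) - i) = (-1) ^ e * poch ((d:ℝ) + 1) e := by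
    unfold poch
    rw [← Finset.card_range e, ← Finset.prod_const, Finset.card_range, ← Finset.prod_mul_distrib]
    apply Finset.prod_congr rfl
    intro i _
    push_cast
    ring
  rw [this, poch_nat]
  field_simp

theorem gbinom_nat (d e : ℕ) : gbinom ((d:ℤ)) e = d.choose e := by
  unfold gbinom
  have : ∏ i ∈ Finset.range e, (((d:ℤ) : ℝ) - i) = d.descFactorial e := by
    induction e with
    | zero => simp
    | succ j ih =>
      rw [Finset.prod_range_succ, ih, Nat.descFactorial_succ]
      rcases le_or_gt j d with h | h
      · push_cast [Nat.cast_sub h]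
        ring
      · rw [Nat.descFactorial_of_lt h]; simp
  rw [this, Nat.descFactorial_eq_factorial_mul_choose]
  push_cast
  field_simp

theorem Wp_coeff (a : ℝ) (M p d : ℕ) : (Wp a M p).coeff d =
    ∑ j ∈ Finset.range (d + 1), (M.choose j : ℝ) * (p.choose (d - j) * a ^ (d - j)) := by
  have h : (1 + C a * X : ℝ[X]) ^ p = ((1 + X) ^ p).comp (C a * X) := by simp
  rw [Wp, coeff_mul, Finset.Nat.sum_antidiagonal_eq_sum_range_succ_mk]
  apply Finset.sum_congr rfl
  intro j _
  simp only [h, comp_C_mul_X_coeff, coeff_one_add_X_pow]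

theorem gbinom_Fm_eq_Wp (a : ℝ) (ha : a ≠ 0) (M d e : ℕ) (hM : d ≤ M) :
    a ^ d * (gbinom (-(d:ℤ) - 1) e * Fm M (-(d:ℝ)) (e + 1) a⁻¹) = (-1) ^ e * (Wp a M (d + e)).coeff d := by
  have : Fm M (-(d:ℝ)) (e + 1) a⁻¹ = ∑ j ∈ Finset.range (d + 1), fm M (-(d:ℝ)) (e + 1) j * a⁻¹ ^ j := by
    unfold Fm
    symm
    apply Finset.sum_subset
    · intro j; simp; omega
    · intro j _ hj
      have hj : d < j := by simpa using hj
      simp [fm, poch_neg_eq_zero d j hj]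
  rw [this, Wp_coeff, gbinom_neg, Finset.mul_sum, Finset.mul_sum, Finset.mul_sum]
  apply Finset.sum_congr rfl
  intro j hj
  obtain ⟨i, rfl⟩ : ∃ i, d = i + j := ⟨d - j, by have := Finset.mem_range.mp hj; omega⟩
  rw [fm, poch_neg, poch_neg, poch_nat, Nat.add_sub_cancel, ← Nat.choose_symm_add, Nat.cast_add_choose,
    show i + j + e = i + (e + j) by ring, Nat.cast_add_choose]
  have : ((-1:ℝ) ^ j) * (-1) ^ j = 1 := by rw [← mul_pow]; simp
  rw [inv_pow, pow_add]
  field_simp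
  linear_combination (M.choose j : ℝ) * this

noncomputable def Rh (a : ℝ) (n m k : ℕ) : ℝ :=
  (-1 : ℝ) ^ (n + m - 1) * a ^ (n + k + 1) * (1 - a) ^ ((k : ℤ) - n) *
      (poch (1/2) (n + m - k) * poch (1/2) k) / (poch (1/2) n * poch (1/2) m) *
      gbinom ((n : ℤ) - k - 1) (n + m - 2 * k - 1) *
      Fm (n + m + 1) ((n : ℝ) - k) ((n : ℝ) + m - 2 * k) a⁻¹

theorem case1 (a : ℝ) (ha : a ≠ 0) (n m k : ℕ) (hn : n ≤ k) (hk : 2 * k + 1 ≤ n + m) :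
    Lc k (Pq a n m) = Rh a n m k := by
  obtain ⟨d, rfl⟩ := Nat.exists_eq_add_of_le hn
  obtain ⟨e, rfl⟩ : ∃ e, m = n + d + 1 + (d + e) := ⟨n + m - 2 * (n + d) - 1, by omega⟩
  rw [Pq_formula, Rh]
  have h := gbinom_Fm_eq_Wp a ha (n + (n + d + 1 + (d + e)) + 1) d e (by omega)
  rw [show n + (n + d + 1 + (d + e)) - 2 * (n + d) - 1 = e by omega,
    show n + (n + d + 1 + (d + e)) - (n + d) = n + (d + e) + 1 by omega,
    show ((n:ℤ) - ((n + d : ℕ) : ℤ) - 1) = -(d:ℤ) - 1 by push_cast; ring,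
    show ((n:ℝ) - ((n + d : ℕ) : ℝ)) = -(d:ℝ) by push_cast; ring,
    show ((n:ℝ) + ((n + d + 1 + (d + e) : ℕ) : ℝ) - 2 * ((n + d : ℕ) : ℝ)) = e + 1 by push_cast; ring,
    show (((n + d : ℕ) : ℤ) - n) = d by push_cast; ring, zpow_natCast,
    show n + (n + d) + 1 = 2 * n + 1 + d by ring,
    show n + (n + d + 1 + (d + e)) - 1 = 2 * (n + d) + e by omega]
  rw [show n + (n + d + 1 + (d + e)) + 1 = 2 * n + d + (d + e) + 2 by ring] at h ⊢
  have s : ((-1:ℝ) ^ e) * (-1) ^ e = 1 := by rw [← mul_pow]; simp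
  have hW : (Wp a (2 * n + d + (d + e) + 2) (d + e)).coeff d = (-1) ^ e *
    (a ^ d * (gbinom (-(d:ℤ) - 1) e * Fm (2 * n + d + (d + e) + 2) (-(d:ℝ)) (e + 1) a⁻¹)) := by
    rw [h, ← mul_assoc, s, one_mul]
  rw [hW, pow_add (-1 : ℝ) (2 * _), pow_mul (-1 : ℝ), neg_one_sq, one_pow]
  ring

theorem Pq_symm (a : ℝ) (n m : ℕ) : Pq a n m = Pq (1 - a) m n := by
  simp only [Pq, sub_sub_cancel]
  ring

theorem Rh_symm (a : ℝ) (ha : a ≠ 0) (ha1 : a ≠ 1) (n m k : ℕ) (hm : m ≤ k) (hk : 2 * k + 1 ≤ n + m) :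
    Rh a n m k = Rh (1 - a) m n k := by
  obtain ⟨d, rfl⟩ := Nat.exists_eq_add_of_le hm
  obtain ⟨e, rfl⟩ : ∃ e, n = m + d + 1 + (d + e) := ⟨n + m - 2 * (m + d) - 1, by omega⟩
  have hc : 1 - a ≠ 0 := sub_ne_zero.mpr ha1.symm
  unfold Rh
  have hp := pfaff a⁻¹ (by simpa using ha1) (m + (m + d + 1 + (d + e)) + 1) ((d + e + 1 : ℕ) : ℝ) (e + 1) (by positivity)
  rw [show m + (m + d + 1 + (d + e)) - 2 * (m + d) - 1 = e by omega,
    show (m + d + 1 + (d + e)) + m - 2 * (m + d) - 1 = e by omega,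
    show m + (m + d + 1 + (d + e)) - (m + d) = m + (d + e) + 1 by omega,
    show (m + d + 1 + (d + e)) + m - (m + d) = m + (d + e) + 1 by omega,
    show ((m:ℤ) - ((m + d : ℕ) : ℤ) - 1) = -(d:ℤ) - 1 by push_cast; ring,
    show (((m + d + 1 + (d + e) : ℕ) : ℤ) - ((m + d : ℕ) : ℤ) - 1) = ((d + e : ℕ) : ℤ) by push_cast; ring,
    show ((m:ℝ) - ((m + d : ℕ) : ℝ)) = -(d:ℝ) by push_cast; ring,
    show (((m + d + 1 + (d + e) : ℕ) : ℝ) - ((m + d : ℕ) : ℝ)) = ((d + e + 1 : ℕ) : ℝ) by push_cast; ring,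
    show ((m:ℝ) + ((m + d + 1 + (d + e) : ℕ) : ℝ) - 2 * ((m + d : ℕ) : ℝ)) = e + 1 by push_cast; ring,
    show (((m + d + 1 + (d + e) : ℕ) : ℝ) + m - 2 * ((m + d : ℕ) : ℝ)) = e + 1 by push_cast; ring,
    show (((m + d : ℕ) : ℤ) - m) = d by push_cast; ring, zpow_natCast,
    show (((m + d : ℕ) : ℤ) - ((m + d + 1 + (d + e) : ℕ) : ℤ)) = -((d + e + 1 : ℕ) : ℤ) by push_cast; ring,
    zpow_neg, zpow_natCast,
    show m + (m + d + 1 + (d + e)) - 1 = 2 * (m + d) + e by omega,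
    show (m + d + 1 + (d + e)) + m - 1 = 2 * (m + d) + e by omega,
    show (m + d + 1 + (d + e)) + m + 1 = m + (m + d + 1 + (d + e)) + 1 by ring,
    hp, gbinom_neg, gbinom_nat, add_comm d e, Nat.cast_add_choose]
  rw [show ((e:ℝ) + 1 - ((e + d + 1 : ℕ) : ℝ)) = -(d:ℝ) by push_cast; ring,
    show a⁻¹ / (a⁻¹ - 1) = (1 - a)⁻¹ by
      have : a⁻¹ - 1 = (1 - a) / a := by field_simp
      rw [this]; field_simp]
  generalize Fm (m + (m + d + 1 + (e + d)) + 1) (-(d:ℝ)) (e + 1) (1 - a)⁻¹ = F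
  rw [show 1 - a⁻¹ = (-1) * ((1 - a) * a⁻¹) by field_simp; ring, mul_pow, mul_pow, inv_pow, sub_sub_cancel]
  have s : (-1:ℝ) ^ (m + (m + d + 1 + (e + d)) + 1) = (-1) ^ e := by
    rw [show m + (m + d + 1 + (e + d)) + 1 = 2 * (m + d + 1) + e by ring, pow_add, pow_mul]; simp
  rw [s]
  generalize (1 - a) = c at *
  have := poch_pos m
  have := poch_pos (m + d + 1 + (e + d))
  field_simp
  ring

theorem Lc_eq_Rh (a : ℝ) (ha : a ≠ 0) (ha1 : a ≠ 1) (n m k : ℕ) (hk : 2 * k + 1 ≤ n + m) :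
    Lc k (Pq a n m) = Rh a n m k := by
  rcases le_or_gt n k with h | h
  · exact case1 a ha n m k h hk
  · rcases le_or_gt m k with h' | h'
    · rw [Pq_symm, Rh_symm a ha ha1 n m k h' hk]
      exact case1 (1 - a) (sub_ne_zero.mpr ha1.symm) m n k h' (by omega)
    · rw [Pq_small a k n m h h', Rh]
      obtain ⟨i, rfl⟩ := Nat.exists_eq_add_of_lt h
      rw [show (((k + i + 1 : ℕ) : ℤ) - k - 1) = (i : ℕ) by push_cast; ring, gbinom_nat,
        Nat.choose_eq_zero_of_lt (by omega)]
      simp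
end

theorem bessel_linearization_lower_2F1
    (n m : ℕ) (hnm : 1 ≤ n + m) (a : ℝ) (ha : a ≠ 0) (ha1 : a ≠ 1)
    (β : ℕ → ℝ)
    (hβ : ∀ u : ℝ, besselQ n (a * u) * besselQ m ((1 - a) * u) =
      ∑ k ∈ Finset.range (n + m + 1), β k * besselQ k u)
    (k : ℕ) (hk : k ≤ (n + m - 1) / 2) :
    β k = (-1 : ℝ) ^ (n + m - 1) * a ^ (n + k + 1) * (1 - a) ^ ((k : ℤ) - n) *
      (poch (1/2) (n + m - k) * poch (1/2) k) / (poch (1/2) n * poch (1/2) m) *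
      gbinom ((n : ℤ) - k - 1) (n + m - 2 * k - 1) *
      ∑ j ∈ Finset.range (n + m + 1 + 1),
        poch (-(m : ℝ) - n - 1) j * poch ((n : ℝ) - k) j /
          (poch ((n : ℝ) + m - 2 * k) j * j.factorial) * a ^ (-(j : ℤ)) := by
  have hP : Pq a n m = ∑ k ∈ Finset.range (n + m + 1), β k • bq k := by
    apply Polynomial.funext
    intro u
    simp only [Pq, Polynomial.eval_mul, Polynomial.eval_comp, Polynomial.eval_C, Polynomial.eval_X,
      bq_eval, Polynomial.eval_finsetSum, Polynomial.eval_smul, smul_eq_mul]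
    exact hβ u
  have h1 : Lc k (Pq a n m) = β k := by
    rw [hP, map_sum]
    simp only [map_smul, Lc_bq, smul_eq_mul, mul_ite, mul_one, mul_zero]
    rw [Finset.sum_ite_eq', if_pos (Finset.mem_range.mpr (by omega))]
  rw [← h1, Lc_eq_Rh a ha ha1 n m k (by omega), Rh]
  congr 1
  unfold Fm fm
  apply Finset.sum_congr rfl
  intro j _
  rw [zpow_neg, zpow_natCast, inv_pow,
    show -(m:ℝ) - n - 1 = -((n + m + 1 : ℕ) : ℝ) by push_cast; ring]
end

section
/- (Positivity) Let n, m be natural numbers with n < m, let k be a natural number with n ≤ k < m, and let a be a real number with 0 < a < 1. Then the linearization coefficient β_k^{(n,m)}(a) is strictly positive. -/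
open Finset

open Polynomial in
/-- coefficients of the Bessel polynomial -/
noncomputable def qc (n k : ℕ) : ℝ :=
  if k ≤ n then ((n.factorial : ℝ) * (2 * n - k).factorial * 2 ^ k) /
      ((2 * n).factorial * (n - k).factorial * k.factorial) else 0

open Polynomial in
noncomputable def Qp (n : ℕ) : ℝ[X] := ∑ k ∈ Finset.range (n + 1), C (qc n k) * X ^ k

open Polynomial in
lemma Qp_coeff (n k : ℕ) : (Qp n).coeff k = qc n k := by
  unfold Qp
  simp only [finsetSum_coeff, coeff_C_mul_X_pow]
  simp only [Finset.sum_ite_eq, Finset.mem_range]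
  split_ifs with h
  · rfl
  · unfold qc; rw [if_neg (by omega)]

open Polynomial in
lemma Qp_eval (n : ℕ) (u : ℝ) : (Qp n).eval u = besselQ n u := by
  unfold Qp besselQ
  rw [eval_finsetSum]
  apply Finset.sum_congr rfl
  intro k hk
  have : k ≤ n := by simp at hk; omega
  simp [qc, this]

lemma qc_zero (n : ℕ) : qc n 0 = 1 := by
  unfold qc
  have h1 : ((2 * n).factorial : ℝ) ≠ 0 := by positivity
  have h2 : (n.factorial : ℝ) ≠ 0 := by positivity
  simp
  field_simp

lemma qc_rec (j i : ℕ) :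
    qc (j+1) (i+1) - (i+2) * qc (j+1) (i+2) = qc j i / (2 * j + 1) := by
  unfold qc
  rcases lt_trichotomy i j with h | h | h
  · obtain ⟨d, rfl⟩ : ∃ d, j = i + 1 + d := ⟨j - i - 1, by omega⟩
    rw [if_pos (by omega), if_pos (by omega), if_pos (by omega)]
    have e1 : 2 * (i + 1 + d + 1) - (i + 1) = (i + 2 * d + 2) + 1 := by omega
    have e2 : 2 * (i + 1 + d + 1) - (i + 2) = i + 2 * d + 2 := by omega
    have e3 : 2 * (i + 1 + d) - i = i + 2 * d + 2 := by omega
    have e4 : i + 1 + d + 1 - (i + 1) = d + 1 := by omega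
    have e5 : i + 1 + d + 1 - (i + 2) = d := by omega
    have e6 : i + 1 + d - i = d + 1 := by omega
    have e7 : 2 * (i + 1 + d + 1) = (2 * (i + 1 + d)) + 1 + 1 := by omega
    rw [e1, e2, e3, e4, e5, e6, e7]
    generalize hA : i + 2 * d + 2 = A
    have hA' : (A : ℝ) = i + 2 * d + 2 := by rw [← hA]; push_cast; ring
    simp only [Nat.factorial_succ (2 * (i+1+d) + 1), Nat.factorial_succ (2 * (i+1+d)),
      Nat.factorial_succ A, Nat.factorial_succ d, Nat.factorial_succ (i+1+d),
      Nat.factorial_succ (i+1), Nat.factorial_succ i]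
    push_cast
    rw [hA']
    have h1 : ((2 * (i + 1 + d)).factorial : ℝ) ≠ 0 := by positivity
    have h2 : ((i + 1 + d).factorial : ℝ) ≠ 0 := by positivity
    have h3 : (A.factorial : ℝ) ≠ 0 := by positivity
    have h4 : (d.factorial : ℝ) ≠ 0 := by positivity
    have h5 : (i.factorial : ℝ) ≠ 0 := by positivity
    field_simp
    ring
  · subst h
    rw [if_pos (by omega), if_neg (by omega), if_pos (by omega)]
    have e1 : 2 * (i + 1) - (i + 1) = i + 1 := by omega
    have e2 : 2 * i - i = i := by omega
    have e7 : 2 * (i + 1) = (2 * i) + 1 + 1 := by omega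
    rw [e1, e2, e7]
    simp only [Nat.factorial_succ (2 * i + 1), Nat.factorial_succ (2 * i), Nat.factorial_succ i,
      Nat.sub_self, Nat.factorial_zero]
    push_cast
    have h1 : ((2 * i).factorial : ℝ) ≠ 0 := by positivity
    have h5 : (i.factorial : ℝ) ≠ 0 := by positivity
    field_simp
    ring
  · rw [if_neg (by omega), if_neg (by omega), if_neg (by omega)]; simp

lemma qc_one (n : ℕ) : qc (n+1) 1 = 1 := by
  unfold qc
  rw [if_pos (by omega)]
  have e1 : 2 * (n + 1) - 1 = 2 * n + 1 := by omega
  have e7 : 2 * (n + 1) = (2 * n) + 1 + 1 := by omega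
  rw [e1, e7]
  simp only [Nat.factorial_succ (2 * n + 1), Nat.factorial_succ n, Nat.add_sub_cancel,
    Nat.factorial_one]
  push_cast
  have h1 : ((2 * n + 1).factorial : ℝ) ≠ 0 := by positivity
  have h5 : (n.factorial : ℝ) ≠ 0 := by positivity
  field_simp
  ring

open Polynomial in
lemma Qp_ode (j : ℕ) :
    Qp (j+1) - derivative (Qp (j+1)) = C (1 / (2 * (j:ℝ) + 1)) * (X * Qp j) := by
  ext i
  rw [coeff_sub, coeff_derivative, coeff_C_mul]
  rcases i with _ | i
  · simp [Qp_coeff, qc_zero, qc_one]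
  · rw [coeff_X_mul, Qp_coeff, Qp_coeff, Qp_coeff]
    have := qc_rec j i
    push_cast
    rw [show i + 1 + 1 = i + 2 from rfl]
    linear_combination this

open Polynomial in
/-- the coordinate functionals -/
noncomputable def Lf : ℕ → ℝ[X] → ℝ
  | 0, p => p.coeff 0 - p.coeff 1
  | k+1, p => (2 * k + 1) * Lf k (divX (p - derivative p))

open Polynomial in
lemma Lf_add (k : ℕ) : ∀ p q : ℝ[X], Lf k (p + q) = Lf k p + Lf k q := by
  induction k with
  | zero => intro p q; simp [Lf]; ring
  | succ k ih =>
    intro p q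
    simp only [Lf]
    rw [← mul_add, ← ih, ← divX_add]
    congr 3
    simp; ring

open Polynomial in
lemma Lf_smul (k : ℕ) : ∀ (c : ℝ) (p : ℝ[X]), Lf k (C c * p) = c * Lf k p := by
  induction k with
  | zero => intro p q; simp [Lf]; ring
  | succ k ih =>
    intro c p
    simp only [Lf]
    have : C c * p - derivative (C c * p) = C c * (p - derivative p) := by simp; ring
    rw [this, divX_C_mul, ih]; ring

open Polynomial in
lemma Lf_zero (k : ℕ) : Lf k 0 = 0 := by
  simpa using Lf_smul k 0 0

open Polynomial in
lemma Lf_sum (k : ℕ) {ι : Type*} (s : Finset ι) (f : ι → ℝ[X]) :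
    Lf k (∑ i ∈ s, f i) = ∑ i ∈ s, Lf k (f i) := by
  classical
  induction s using Finset.induction_on with
  | empty => simp [Lf_zero]
  | insert a s ha ih => rw [Finset.sum_insert ha, Finset.sum_insert ha, Lf_add, ih]

open Polynomial in
lemma Lf_step (k : ℕ) (p r : ℝ[X]) (h : p - derivative p = X * r) :
    Lf (k+1) p = (2 * k + 1) * Lf k r := by
  simp only [Lf]
  rw [h]
  congr 2
  ext i; simp [coeff_divX, coeff_X_mul]

lemma Lf_Qp (k : ℕ) : ∀ j, Lf k (Qp j) = if j = k then 1 else 0 := by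
  induction k with
  | zero =>
    intro j
    simp only [Lf, Qp_coeff, qc_zero]
    rcases j with _ | j
    · simp [qc]
    · simp [qc_one]
  | succ k ih =>
    intro j
    rcases j with _ | j
    · have : Qp 0 = Polynomial.C 1 := by simp [Qp, qc]
      simp [Lf, this, Lf_zero]
    · rw [Lf_step k _ (Polynomial.C (1 / (2 * (j:ℝ) + 1)) * Qp j), Lf_smul, ih]
      · by_cases h : j = k
        · subst h
          have : 2 * (j:ℝ) + 1 ≠ 0 := by positivity
          simp; field_simp
        · simp [h]
      · rw [Qp_ode]; ring

noncomputable def dk (k : ℕ) : ℝ := ∏ j ∈ Finset.range k, (2 * (j:ℝ) + 1)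

lemma dk_pos (k : ℕ) : 0 < dk k := Finset.prod_pos (fun _ _ => by positivity)

noncomputable def ek (k : ℕ) : ℕ → ℝ
  | 0 => 1
  | r+1 => (k.choose (r+1) : ℝ) + 2 * k.choose r

lemma ek_eq (k r : ℕ) : ((k:ℝ) + 1 + r) * (k+1).choose r = (k + 1) * ek k r := by
  rcases r with _ | r
  · simp [ek]
  · have h1 : ((k+1).choose (r+1) : ℝ) = k.choose r + k.choose (r+1) := by
      exact_mod_cast Nat.choose_succ_succ k r
    have h2 : ((k:ℝ)+1) * k.choose r = (k+1).choose (r+1) * (r+1) := by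
      exact_mod_cast Nat.add_one_mul_choose_eq k r
    simp only [ek]
    push_cast
    linear_combination ((k:ℝ)+1) * h1 - h2

noncomputable def dd (k r : ℕ) : ℝ :=
  (-1)^r * dk k / 2^r * ((k+r+1).factorial / (k+1).factorial) * (k+1).choose r

lemma dd_zero (k : ℕ) : dd (k+1) 0 = (2 * k + 1) * dd k 0 := by
  have h1 : ((k+1).factorial : ℝ) ≠ 0 := by positivity
  have h2 : ((k+1+1).factorial : ℝ) ≠ 0 := by positivity
  simp [dd, dk, Finset.prod_range_succ]
  field_simp

lemma dd_succ (k r : ℕ) :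
    dd (k+1) (r+1) = (2 * k + 1) * (dd k (r+1) - (k + r + 2) * dd k r) := by
  have h1 : ((k+1).factorial : ℝ) ≠ 0 := by positivity
  have h3 : ((k+r+1).factorial : ℝ) ≠ 0 := by positivity
  have he := ek_eq (k+1) (r+1)
  simp only [ek] at he
  push_cast at he
  have hc : ((k+1+1).choose (r+1) : ℝ) = 
     (k + 2) * (((k+1).choose (r+1) : ℝ) + 2 * (k+1).choose r) / (k + r + 3) := by
    have : (k:ℝ) + r + 3 ≠ 0 := by positivity
    field_simp
    linear_combination he
  have hd : dk (k+1) = dk k * (2 * k + 1) := by simp [dk, Finset.prod_range_succ]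
  unfold dd
  rw [hc, hd]
  have e1 : k + 1 + (r + 1) + 1 = k + r + 1 + 1 + 1 := by ring
  have e2 : k + (r + 1) + 1 = k + r + 1 + 1 := by ring
  rw [e1, e2]
  simp only [Nat.factorial_succ (k+r+1+1), Nat.factorial_succ (k+r+1), Nat.factorial_succ (k+1)]
  push_cast
  field_simp
  ring

open Polynomial in
lemma Lf_X_one (k : ℕ) : Lf (k+1) X = (2 * k + 1) * Lf k 1 := by
  simp only [Lf]
  congr 2
  ext i
  simp [coeff_divX, coeff_X, coeff_one]

open Polynomial in
lemma Lf_X_succ (k i : ℕ) :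
    Lf (k+1) (X^(i+2)) = (2 * k + 1) * (Lf k (X^(i+1)) - (i + 2) * Lf k (X^i)) := by
  rw [Lf_step k _ (X^(i+1) + C (-((i:ℝ)+2)) * X^i), Lf_add, Lf_smul]
  · ring
  · have h2 : (C (2:ℝ) : ℝ[X]) = 2 := rfl
    simp [h2]
    ring

open Polynomial in
lemma Lf_lt (k : ℕ) : ∀ i, i < k → Lf k (X^i) = 0 := by
  induction k with
  | zero => intro i hi; omega
  | succ k ih =>
    intro i hi
    rcases i with _ | _ | i
    · simp [Lf, Lf_zero]
    · have := ih 0 (by omega)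
      rw [pow_zero] at this
      rw [zero_add, pow_one, Lf_X_one, this, mul_zero]
    · rw [Lf_X_succ, ih _ (by omega), ih _ (by omega)]; simp

open Polynomial in
lemma Lf_X_add (k : ℕ) : ∀ r, Lf k (X^(k+r)) = dd k r := by
  induction k with
  | zero =>
    intro r
    rcases r with _ | _ | r
    · simp [Lf, dd, dk, coeff_one]
    · simp [Lf, dd, dk]
    · simp [Lf, dd, dk, coeff_X_pow, Nat.choose]
  | succ k ih =>
    intro r
    rcases r with _ | r
    · rw [dd_zero, ← ih 0]
      rcases k with _ | k
      · have := Lf_X_one 0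
        simpa using this
      · rw [show k + 1 + 1 + 0 = k + 2 from rfl, Lf_X_succ, Lf_lt (k+1) k (by omega)]
        simp
    · rw [dd_succ, ← ih, ← ih, show k + 1 + (r + 1) = (k + r) + 2 by ring, Lf_X_succ]
      push_cast
      rfl

open PowerSeries in
lemma coeff_oneadd (k r : ℕ) : coeff r ((1 + X : ℝ⟦X⟧)^k) = k.choose r := by
  have : ((1 + X : ℝ⟦X⟧)^k) = (((1 + Polynomial.X : Polynomial ℝ)^k : Polynomial ℝ) : ℝ⟦X⟧) := by
    simp
  rw [this, Polynomial.coeff_coe, Polynomial.coeff_one_add_X_pow]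

open PowerSeries in
lemma coeff_poly (b : ℝ) (k r : ℕ) :
    coeff r ((1 - C b * X : ℝ⟦X⟧)^k * (1 - C (2 * b) * X)) = (-b)^r * ek k r := by
  have h : (1 - C b * X : ℝ⟦X⟧)^k * (1 - C (2 * b) * X)
      = rescale (-b) ((1 + X)^k * (1 + C 2 * X)) := by
    have hC : rescale (-b) (C (2:ℝ)) = C 2 := by
      ext i; rcases i with _ | i <;> simp [coeff_rescale, coeff_C]
    have e : rescale (-b) ((1 + X)^k * (1 + C 2 * X)) =
        (rescale (-b) 1 + rescale (-b) X)^k *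
          (rescale (-b) 1 + rescale (-b) (C (2:ℝ)) * rescale (-b) X) := by
      simp only [RingHom.map_mul, RingHom.map_pow, RingHom.map_add]
    rw [e, RingHom.map_one, rescale_X, hC, RingHom.map_mul C, show (C (-b) : ℝ⟦X⟧) = - C b from by ext i; simp [coeff_C]]
    ring
  rw [h, coeff_rescale]
  congr 1
  rw [mul_add, mul_one, map_add, coeff_oneadd]
  rcases r with _ | r
  · simp [ek]
  · rw [← mul_assoc, coeff_succ_mul_X, mul_comm, coeff_C_mul, coeff_oneadd]
    simp [ek]

open PowerSeries in
lemma coeff_F (d n : ℕ) : coeff n ((mk 1 : ℝ⟦X⟧)^(d+1)) = (d + n).choose d := by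
  rw [mk_one_pow_eq_mk_choose_add]; simp

open PowerSeries in
lemma pow_nonneg_coeff (p : ℝ⟦X⟧) (h : ∀ n, 0 ≤ coeff n p) (h0 : coeff 0 p = 1) (k : ℕ) :
    (∀ n, 0 ≤ coeff n (p^k)) ∧ coeff 0 (p^k) = 1 := by
  induction k with
  | zero => 
    constructor
    · intro n; rw [pow_zero, coeff_one]; split_ifs <;> norm_num
    · simp
  | succ k ih =>
    constructor
    · intro n
      rw [pow_succ, coeff_mul]
      exact Finset.sum_nonneg (fun x _ => mul_nonneg (ih.1 _) (h _))
    · rw [pow_succ, coeff_mul]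
      rw [Finset.Nat.antidiagonal_zero, Finset.sum_singleton]
      rw [ih.2, h0, one_mul]

open PowerSeries in
lemma tail_pos (b : ℝ) (hb : 0 < b) (hb1 : b < 1) (N j : ℕ) (hj : j ≤ N) :
    0 < coeff j ((1 - C (2 * b) * X) * (mk 1 : ℝ⟦X⟧)^(N+1)) := by
  rw [sub_mul, one_mul, map_sub, coeff_F, mul_assoc, coeff_C_mul]
  rcases j with _ | i
  · simp
  · rw [coeff_succ_X_mul, coeff_F]
    have h := Nat.choose_mul_succ_eq (N + i) N
    rw [show N + i + 1 - N = i + 1 by omega] at h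
    have h' : ((N+i).choose N : ℝ) * (N + i + 1) = (N+i+1).choose N * (i + 1) := by
      exact_mod_cast h
    have p1 : 0 < ((N+i).choose N : ℝ) := by exact_mod_cast Nat.choose_pos (by omega)
    have p2 : 0 < ((N+i+1).choose N : ℝ) := by exact_mod_cast Nat.choose_pos (by omega)
    have hN : (i:ℝ) + 1 ≤ N := by exact_mod_cast hj
    rw [← add_assoc]
    have key : 2 * ((N+i).choose N : ℝ) ≤ (N+i+1).choose N := by
      have hi : (0:ℝ) < i + 1 := by positivity
      apply le_of_mul_le_mul_right _ hi
      nlinarith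
    nlinarith

open PowerSeries in
lemma S_pos (b : ℝ) (hb : 0 < b) (hb1 : b < 1) (k N : ℕ) :
    0 < ∑ r ∈ Finset.range (N+1), (-b)^r * ek k r * ((k + N + (N - r)).choose (k + N) : ℝ) := by
  have h : ∑ r ∈ Finset.range (N+1), (-b)^r * ek k r * ((k + N + (N - r)).choose (k + N) : ℝ)
    = coeff N (((1 - C b * X : ℝ⟦X⟧)^k * (1 - C (2 * b) * X)) * (mk 1 : ℝ⟦X⟧)^(k+N+1)) := by
    rw [coeff_mul, Finset.Nat.sum_antidiagonal_eq_sum_range_succ_mk]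
    apply Finset.sum_congr rfl
    intro r _
    rw [coeff_poly, coeff_F]
  have h2 : ((1 - C b * X : ℝ⟦X⟧)^k * (1 - C (2 * b) * X)) * (mk 1 : ℝ⟦X⟧)^(k+N+1)
    = ((1 - C b * X) * (mk 1 : ℝ⟦X⟧))^k * ((1 - C (2 * b) * X) * (mk 1 : ℝ⟦X⟧)^(N+1)) := by
    rw [mul_pow]; ring
  rw [h, h2]
  obtain ⟨q1, q2⟩ := pow_nonneg_coeff ((1 - C b * X) * (mk 1 : ℝ⟦X⟧)) (by
    intro n
    rw [sub_mul, one_mul, map_sub, mul_assoc, coeff_C_mul]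
    rcases n with _ | n
    · simp
    · rw [coeff_succ_X_mul]; simp; linarith) (by simp) k
  rw [coeff_mul]
  apply Finset.sum_pos'
  · intro x hx
    have := Finset.HasAntidiagonal.mem_antidiagonal.mp hx
    exact mul_nonneg (q1 _) (tail_pos b hb hb1 N _ (by omega)).le
  · refine ⟨(0, N), by simp, ?_⟩
    simp only [q2, one_mul]
    exact tail_pos b hb hb1 N _ le_rfl

lemma qc_dd (k N r : ℕ) (hr : r ≤ N) : qc (k+N) (k+r) * dd k r =
    ((k+N).factorial * (k+N).factorial * 2^k * dk k / ((2*(k+N)).factorial * k.factorial)) *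
      ((-1)^r * ek k r * ((k + N + (N - r)).choose (k + N) : ℝ)) := by
  unfold qc dd
  rw [if_pos (by omega)]
  obtain ⟨s, rfl⟩ := Nat.exists_eq_add_of_le hr
  have e1 : 2 * (k + (r + s)) - (k + r) = k + (r+s) + s := by omega
  have e2 : k + (r + s) - (k + r) = s := by omega
  have e3 : r + s - r = s := by omega
  rw [e1, e2, e3]
  have hc : ((k + (r+s) + s).factorial : ℝ) =
      (k + (r+s) + s).choose (k + (r + s)) * (k + (r+s)).factorial * s.factorial := by
    have := Nat.add_choose_mul_factorial_mul_factorial (k + (r+s)) s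
    rw [← Nat.choose_symm_add] at this
    exact_mod_cast this.symm
  rw [hc]
  have he : ek k r = ((k:ℝ) + 1 + r) * (k+1).choose r / (k + 1) := by
    rw [ek_eq]; field_simp
  rw [he]
  have h1 : ((2 * (k + (r+s))).factorial : ℝ) ≠ 0 := by positivity
  have h2 : (k.factorial : ℝ) ≠ 0 := by positivity
  have h3 : ((k+r).factorial : ℝ) ≠ 0 := by positivity
  have h4 : (s.factorial : ℝ) ≠ 0 := by positivity
  simp only [Nat.factorial_succ (k+r), Nat.factorial_succ k]
  push_cast
  field_simp
  ring

open Polynomial in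
noncomputable def Ps (b : ℝ) (n : ℕ) : ℝ[X] := (Qp n).comp (C b * X)

open Polynomial in
lemma base_pos (b : ℝ) (hb : 0 < b) (hb1 : b < 1) (k N : ℕ) : 0 < Lf k (Ps b (k+N)) := by
  have h : Ps b (k+N) = ∑ i ∈ Finset.range (k + (N + 1)), C (qc (k+N) i * b^i) * X^i := by
    unfold Ps Qp
    rw [Polynomial.sum_comp]
    apply Finset.sum_congr rfl
    intro i _
    simp [mul_pow]
    ring
  rw [h, Lf_sum, Finset.sum_range_add]
  rw [Finset.sum_eq_zero (s := Finset.range k), zero_add]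
  · have : ∀ r ∈ Finset.range (N+1), Lf k (C (qc (k+N) (k+r) * b^(k+r)) * X^(k+r)) =
      ((k+N).factorial * (k+N).factorial * 2^k * dk k / ((2*(k+N)).factorial * k.factorial) * b^k) *
      ((-b)^r * ek k r * ((k + N + (N - r)).choose (k + N) : ℝ)) := by
      intro r hr
      have := qc_dd k N r (by simp at hr; omega)
      rw [Lf_smul, Lf_X_add, neg_pow b, pow_add]
      linear_combination (b^k * b^r) * this
    rw [Finset.sum_congr rfl this, ← Finset.mul_sum]
    have := dk_pos k
    exact mul_pos (by positivity) (S_pos b hb hb1 k N)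
  · intro i hi
    rw [Lf_smul, Lf_lt k i (by simpa using hi), mul_zero]

open Polynomial in
lemma Ps_ode (b : ℝ) (n : ℕ) :
    derivative (Ps b (n+1)) = C b * Ps b (n+1) - C (b^2 / (2 * (n:ℝ) + 1)) * (X * Ps b n) := by
  have h := congrArg (fun p => p.comp (C b * X)) (Qp_ode n)
  simp only [sub_comp, mul_comp, C_comp, X_comp] at h
  unfold Ps
  rw [derivative_comp]
  have h2 : (C (b^2 / (2 * (n:ℝ) + 1)) : ℝ[X]) = C b * C b * C (1 / (2 * (n:ℝ) + 1)) := by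
    rw [← C_mul, ← C_mul]; congr 1; ring
  have h3 : derivative (C b * X) = C b := by simp
  rw [h2, h3]
  linear_combination (-C b) * h

open Polynomial in
lemma rec_step (a : ℝ) (n m k : ℕ) :
    Lf (k+1) (Ps a (n+1) * Ps (1-a) (m+1)) = (2 * k + 1) *
      (a^2 / (2 * (n:ℝ) + 1) * Lf k (Ps a n * Ps (1-a) (m+1)) +
       (1-a)^2 / (2 * (m:ℝ) + 1) * Lf k (Ps a (n+1) * Ps (1-a) m)) := by
  rw [Lf_step k _ (C (a^2 / (2 * (n:ℝ) + 1)) * (Ps a n * Ps (1-a) (m+1)) +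
    C ((1-a)^2 / (2 * (m:ℝ) + 1)) * (Ps a (n+1) * Ps (1-a) m)), Lf_add, Lf_smul, Lf_smul]
  rw [derivative_mul, Ps_ode, Ps_ode]
  have : (C (1 - a) : ℝ[X]) = 1 - C a := by simp
  rw [this]
  ring

open Polynomial in
lemma vanish (a : ℝ) (k : ℕ) : ∀ n m, k < n → k < m → Lf k (Ps a n * Ps (1-a) m) = 0 := by
  induction k with
  | zero =>
    intro n m hn hm
    obtain ⟨n, rfl⟩ : ∃ n', n = n' + 1 := ⟨n - 1, by omega⟩
    obtain ⟨m, rfl⟩ : ∃ m', m = m' + 1 := ⟨m - 1, by omega⟩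
    simp only [Lf, mul_coeff_zero, mul_coeff_one, Ps, comp_C_mul_X_coeff, Qp_coeff, qc_zero, qc_one]
    ring
  | succ k ih =>
    intro n m hn hm
    obtain ⟨n, rfl⟩ : ∃ n', n = n' + 1 := ⟨n - 1, by omega⟩
    obtain ⟨m, rfl⟩ : ∃ m', m = m' + 1 := ⟨m - 1, by omega⟩
    rw [rec_step, ih _ _ (by omega) (by omega), ih _ _ (by omega) (by omega)]
    simp

open Polynomial in
lemma main_pos (a : ℝ) (ha : 0 < a) (ha1 : a < 1) (k : ℕ) :
    ∀ n m, n ≤ k → k < m → 0 < Lf k (Ps a n * Ps (1-a) m) := by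
  have base : ∀ k m, k < m → 0 < Lf k (Ps a 0 * Ps (1-a) m) := by
    intro k m hm
    obtain ⟨N, rfl⟩ := Nat.exists_eq_add_of_le hm.le
    have : Ps a 0 = 1 := by simp [Ps, Qp, qc]
    rw [this, one_mul]
    exact base_pos _ (by linarith) (by linarith) k N
  induction k with
  | zero =>
    intro n m hn hm
    obtain rfl : n = 0 := by omega
    exact base _ _ hm
  | succ k ih =>
    intro n m hn hm
    rcases n with _ | n
    · exact base _ _ hm
    obtain ⟨m, rfl⟩ : ∃ m', m = m' + 1 := ⟨m - 1, by omega⟩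
    rw [rec_step]
    have h1 := ih n (m+1) (by omega) (by omega)
    have h2 : 0 ≤ Lf k (Ps a (n+1) * Ps (1-a) m) := by
      by_cases h : n + 1 ≤ k
      · exact (ih _ _ h (by omega)).le
      · exact (vanish a k _ _ (by omega) (by omega)).ge
    positivity

theorem bessel_linearization_positivity
    (n m : ℕ) (hnm : n < m) (k : ℕ) (hnk : n ≤ k) (hkm : k < m)
    (a : ℝ) (ha : 0 < a) (ha1 : a < 1)
    (β : ℕ → ℝ)
    (hβ : ∀ u : ℝ, besselQ n (a * u) * besselQ m ((1 - a) * u) =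
      ∑ j ∈ Finset.range (n + m + 1), β j * besselQ j u) :
    0 < β k := by

  have hp : Ps a n * Ps (1-a) m =
      ∑ j ∈ Finset.range (n + m + 1), Polynomial.C (β j) * Qp j := by
    apply Polynomial.funext
    intro u
    have := hβ u
    simp only [Polynomial.eval_mul, Polynomial.eval_finsetSum, Polynomial.eval_C, Qp_eval, Ps,
      Polynomial.eval_comp, Polynomial.eval_X]
    exact this
  have h := main_pos a ha ha1 k n m hnk hkm
  rw [hp, Lf_sum] at h
  simp only [Lf_smul, Lf_Qp, mul_ite, mul_one, mul_zero, Finset.sum_ite_eq',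
    Finset.mem_range] at h
  rwa [if_pos (by omega)] at h
end
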